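/- arXiv:2505.03340 — 3 statements merged into one kernel-verified Lean document; each statement's English description precedes it below -/
import Mathlib

section
/- Let m ≥ 1 be an integer, δ > -m and β > 0 real parameters, and set c = 2m+β+δ. Let τ ≥ 1 be an integer and let (a_t)_{t ≥ τ} be the real sequence defined by a_τ = m + δ and, for every integer t > τ, a_t = a_{t-1} · ((t-1) + m/c)/(t-1) + mβ/c. Then for every integer t ≥ τ one has a_t = mβt/(m+β+δ) + c₀ · Γ(t + m/c) Γ(τ) / (Γ(t) Γ(τ + m/c)), where c₀ = m + δ − mβτ/(m+β+δ). (This sequence equals the expected degree plus δ, E[D_τ(t)+δ], of the anomaly in the preferential attachment model with an anomaly.) -/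
open Real Filter

/-- Closed form for the expected degree (plus `δ`) of the anomaly in the preferential
attachment model with an anomaly arriving at time `τ`. -/
theorem anomaly_expected_degree_closed_form
    (m : ℕ) (hm : 1 ≤ m) (δ β : ℝ) (hδ : -(m : ℝ) < δ) (hβ : 0 < β)
    (τ : ℕ) (hτ : 1 ≤ τ) (a : ℕ → ℝ)
    (h0 : a τ = m + δ)
    (hrec : ∀ t : ℕ, τ ≤ t →
      a (t + 1) = a t * (((t : ℝ) + m / (2 * m + β + δ)) / t) + m * β / (2 * m + β + δ)) :
    ∀ t : ℕ, τ ≤ t →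
      a t = m * β * t / (m + β + δ)
        + (m + δ - m * β * τ / (m + β + δ)) *
          (Real.Gamma ((t : ℝ) + m / (2 * m + β + δ)) * Real.Gamma τ) /
          (Real.Gamma t * Real.Gamma ((τ : ℝ) + m / (2 * m + β + δ))) := by
  have hm1 : (1 : ℝ) ≤ m := by exact_mod_cast hm
  have hτ1 : (1 : ℝ) ≤ τ := by exact_mod_cast hτ
  have hd : 0 < (m : ℝ) + β + δ := by linarith
  have hc : 0 < 2 * (m : ℝ) + β + δ := by linarith
  have hr : 0 < (m : ℝ) / (2 * m + β + δ) := by positivity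
  have key : (m : ℝ) * β / (m + β + δ) * (m / (2 * m + β + δ)) + m * β / (2 * m + β + δ)
      = m * β / (m + β + δ) := by
    have hd' := hd.ne'
    have hc' := hc.ne'
    rw [div_mul_div_comm, div_add_div _ _ (mul_ne_zero hd' hc') hc',
      div_eq_div_iff (mul_ne_zero (mul_ne_zero hd' hc') hc') hd']
    ring
  have hGτ : Real.Gamma τ ≠ 0 := (Real.Gamma_pos_of_pos (by linarith)).ne'
  have hGτr : Real.Gamma ((τ : ℝ) + m / (2 * m + β + δ)) ≠ 0 :=
    (Real.Gamma_pos_of_pos (by linarith)).ne'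
  intro t ht
  induction t, ht using Nat.le_induction with
  | base =>
    rw [h0, mul_comm (Real.Gamma (τ : ℝ)), mul_div_cancel_right₀ _ (mul_ne_zero hGτr hGτ)]
    ring
  | succ t ht ih =>
    have ht1 : (1 : ℝ) ≤ t := by exact_mod_cast hτ.trans ht
    have htne : (t : ℝ) ≠ 0 := by linarith
    have hGt : Real.Gamma t ≠ 0 := (Real.Gamma_pos_of_pos (by linarith)).ne'
    rw [hrec t ht, ih]
    push_cast
    rw [add_right_comm (t : ℝ) 1, Real.Gamma_add_one htne,
      Real.Gamma_add_one (s := (t : ℝ) + m / (2 * m + β + δ)) (by linarith)]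
    have e1 : (m : ℝ) * β * (t + 1) / (m + β + δ)
        = m * β / (m + β + δ) * t + m * β / (m + β + δ) := by ring
    have e2 : (m : ℝ) * β * t / (m + β + δ) = m * β / (m + β + δ) * t := by ring
    rw [e1, e2]
    generalize (m : ℝ) + δ - m * β * τ / (m + β + δ) = C
    generalize (m : ℝ) * β / (m + β + δ) = K at *
    generalize (m : ℝ) * β / (2 * m + β + δ) = B at *
    generalize (m : ℝ) / (2 * m + β + δ) = r at *
    generalize Real.Gamma (t + r) = G1
    field_simp
    linear_combination (Real.Gamma t * Real.Gamma (τ + r) * t) * key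
end

section
/- Let m ≥ 1 be an integer, δ > -m and β > 0 real parameters, and set c = 2m+β+δ. For a real number a ≥ 1, define, for integers τ ≥ 1, F(τ, a) = mβ(aτ)/(m+β+δ) + (m + δ − mβτ/(m+β+δ)) · Γ(aτ + m/c) Γ(τ) / (Γ(aτ) Γ(τ + m/c)). Then lim_{τ → ∞} F(τ, a)/(aτ) = (mβ/(m+β+δ)) · (1 − a^{−(m+β+δ)/(2m+β+δ)}). -/
open Real Filter

lemma wendel_upper {s x : ℝ} (hs : 0 < s) (hs1 : s < 1) (hx : 0 < x) :
    Real.Gamma (x + s) ≤ x ^ s * Real.Gamma x := by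
  have h := Real.Gamma_mul_add_mul_le_rpow_Gamma_mul_rpow_Gamma (s := x) (t := x + 1)
    (a := 1 - s) (b := s) hx (by linarith) (by linarith) hs (by ring)
  have e : (1 - s) * x + s * (x + 1) = x + s := by ring
  have hG := Real.Gamma_pos_of_pos hx
  rw [e, Real.Gamma_add_one hx.ne', Real.mul_rpow hx.le hG.le] at h
  have e2 : Real.Gamma x ^ (1 - s) * (x ^ s * Real.Gamma x ^ s) = x ^ s * Real.Gamma x := by
    have : Real.Gamma x ^ (1 - s) * Real.Gamma x ^ s = Real.Gamma x := by
      rw [← Real.rpow_add hG]; simp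
    calc _ = x ^ s * (Real.Gamma x ^ (1 - s) * Real.Gamma x ^ s) := by ring
      _ = _ := by rw [this]
  rwa [e2] at h

lemma wendel_lower {s x : ℝ} (hs : 0 < s) (hs1 : s < 1) (hx : 0 < x) :
    x * Real.Gamma x ≤ (x + s) ^ (1 - s) * Real.Gamma (x + s) := by
  have h := wendel_upper (s := 1 - s) (x := x + s) (by linarith) (by linarith) (by linarith)
  rwa [show x + s + (1 - s) = x + 1 by ring, Real.Gamma_add_one hx.ne'] at h

lemma ratio_tendsto {s : ℝ} (hs : 0 < s) (hs1 : s < 1) :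
    Tendsto (fun x : ℝ => Real.Gamma (x + s) / (x ^ s * Real.Gamma x)) atTop (nhds 1) := by
  have h1 : Tendsto (fun x : ℝ => (1 + s / x) ^ (-(1 - s))) atTop (nhds 1) := by
    have h0 : Tendsto (fun x : ℝ => 1 + s / x) atTop (nhds (1 + 0)) :=
      tendsto_const_nhds.add (tendsto_const_nhds.div_atTop tendsto_id)
    have := h0.rpow_const (p := -(1 - s)) (Or.inl (by norm_num))
    simpa using this
  refine tendsto_of_tendsto_of_tendsto_of_le_of_le' h1 tendsto_const_nhds ?_ ?_
  · filter_upwards [eventually_gt_atTop 0] with x hx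
    have hG := Real.Gamma_pos_of_pos hx
    have hp : 0 < x ^ s := Real.rpow_pos_of_pos hx s
    have hq : 0 < (x + s) ^ (1 - s) := Real.rpow_pos_of_pos (by linarith) _
    rw [le_div_iff₀ (by positivity), show 1 + s / x = (x + s) / x by field_simp,
      Real.rpow_neg (by positivity), Real.div_rpow (by positivity) hx.le, inv_div,
      div_mul_eq_mul_div, div_le_iff₀ hq]
    have : x ^ (1 - s) * x ^ s = x := by rw [← Real.rpow_add hx]; simp
    have h := wendel_lower hs hs1 hx
    rw [← mul_assoc, this]
    linarith
  · filter_upwards [eventually_gt_atTop 0] with x hx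
    have hG := Real.Gamma_pos_of_pos hx
    have hp : 0 < x ^ s := Real.rpow_pos_of_pos hx s
    rw [div_le_one (by positivity)]
    exact wendel_upper hs hs1 hx

/-- Asymptotic linear growth rate of the anomaly's degree at time `t = aτ` as `τ → ∞`. -/
theorem anomaly_degree_linear_growth_rate
    (m : ℕ) (hm : 1 ≤ m) (δ β : ℝ) (hδ : -(m : ℝ) < δ) (hβ : 0 < β)
    (a : ℝ) (ha : 1 ≤ a) :
    Filter.Tendsto (fun τ : ℕ =>
      (m * β * (a * τ) / (m + β + δ)
        + (m + δ - m * β * τ / (m + β + δ)) *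
          (Real.Gamma (a * τ + m / (2 * m + β + δ)) * Real.Gamma τ) /
          (Real.Gamma (a * τ) * Real.Gamma ((τ : ℝ) + m / (2 * m + β + δ)))) / (a * τ))
      Filter.atTop
      (nhds ((m * β / (m + β + δ)) *
        (1 - a ^ (-((m + β + δ) / (2 * m + β + δ)))))) := by
  have hm' : (1 : ℝ) ≤ m := by exact_mod_cast hm
  have hk : 0 < m + β + δ := by linarith
  have hc : 0 < 2 * m + β + δ := by linarith
  have hexp : -((m + β + δ) / (2 * m + β + δ)) = m / (2 * m + β + δ) - 1 := by
    have hc' := hc.ne'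
    rw [← neg_div, div_sub_one hc']
    congr 1
    ring
  have hs : 0 < m / (2 * m + β + δ) := by positivity
  have hs1 : m / (2 * m + β + δ) < 1 := by rw [div_lt_one hc]; linarith
  rw [hexp]
  generalize m / (2 * m + β + δ) = s at *
  generalize m + β + δ = k at *
  have ha0 : 0 < a := by linarith
  have hN : Tendsto (fun τ : ℕ => (τ : ℝ)) atTop atTop := tendsto_natCast_atTop_atTop
  have hR1 := (ratio_tendsto hs hs1).comp hN
  have hR2 := (ratio_tendsto hs hs1).comp (hN.const_mul_atTop ha0)
  have hz : Tendsto (fun τ : ℕ => (m + δ) / (τ : ℝ)) atTop (nhds 0) :=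
    tendsto_const_nhds.div_atTop hN
  have hmain := ((((hz.sub_const (m * β / k)).mul (hR2.div hR1 one_ne_zero)).mul_const
    (a ^ (s - 1))).const_add (m * β / k))
  have e : m * β / k + (0 - m * β / k) * (1 / 1) * a ^ (s - 1)
      = m * β / k * (1 - a ^ (s - 1)) := by ring
  rw [e] at hmain
  refine hmain.congr' ?_
  filter_upwards [eventually_gt_atTop 0] with τ hτ
  have ht : (0 : ℝ) < τ := by exact_mod_cast hτ
  simp only [Function.comp_apply, Pi.div_apply]
  generalize (τ : ℝ) = t at *
  have hat : 0 < a * t := by positivity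
  have g1 := Real.Gamma_pos_of_pos ht
  have g2 := Real.Gamma_pos_of_pos hat
  have g3 := Real.Gamma_pos_of_pos (show 0 < t + s by linarith)
  have p1 : 0 < t ^ s := Real.rpow_pos_of_pos ht s
  have p2 : 0 < a ^ s := Real.rpow_pos_of_pos ha0 s
  rw [Real.rpow_sub_one ha0.ne', Real.mul_rpow ha0.le ht.le]
  field_simp
end

section
/- Let m ≥ 1 be an integer, δ > -m and β > 0 real parameters, and set b = m/(2m+δ) and a = m/(2m+β+δ). Fix γ ∈ (0,1) and for each integer t ≥ 2 let τ_t = ⌈t^γ⌉. Then lim_{t → ∞} [Γ(τ_t + b) Γ(t + a) / (Γ(τ_t + a) Γ(t))] / t^{γ b + (1−γ) a} = 1. In particular, the expected degree of the oldest vertex satisfies E[D_1(t) + δ] = ((2m+δ)/Γ(1+b))·t^{γ/(2 + δ/m) + (1−γ)/(2 + β/m + δ/m)}·(1 + o(1)) as t → ∞, so an early anomaly changes the polynomial exponent of the oldest vertex's degree growth. -/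
open Real Filter

/-- Wendel's limit. -/
lemma wendel_limit (c : ℝ) (h0 : 0 < c) (h1 : c < 1) :
    Tendsto (fun n : ℕ => Real.Gamma ((n : ℝ) + c) / (Real.Gamma n * (n : ℝ) ^ c)) atTop
      (nhds 1) := by
  have hlow : Tendsto (fun n : ℕ => ((n : ℝ) / ((n : ℝ) + c)) ^ (1 - c)) atTop (nhds 1) := by
    have h := (tendsto_natCast_div_add_atTop c).rpow_const (p := 1 - c) (Or.inl one_ne_zero)
    simpa using h
  refine tendsto_of_tendsto_of_tendsto_of_le_of_le' hlow tendsto_const_nhds ?_ ?_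
  · filter_upwards [eventually_gt_atTop 0] with n hn
    have hn' : (0 : ℝ) < n := by exact_mod_cast hn
    have hG := Real.Gamma_pos_of_pos hn'
    have hc : (0 : ℝ) < n + c := by positivity
    have hGc := Real.Gamma_pos_of_pos hc
    have h := Real.Gamma_mul_add_mul_le_rpow_Gamma_mul_rpow_Gamma hc
      (by positivity : (0 : ℝ) < n + c + 1) h0 (sub_pos.2 h1) (by ring)
    have e : c * ((n : ℝ) + c) + (1 - c) * (n + c + 1) = n + 1 := by ring
    rw [e, Real.Gamma_add_one hn'.ne', Real.Gamma_add_one hc.ne',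
      Real.mul_rpow hc.le hGc.le, mul_left_comm, ← Real.rpow_add hGc,
      add_sub_cancel, Real.rpow_one] at h
    rw [Real.div_rpow hn'.le hc.le, div_le_div_iff₀ (by positivity) (by positivity)]
    have e2 : (n : ℝ) ^ (1 - c) * (n : ℝ) ^ c = n := by
      rw [← Real.rpow_add hn']; simp
    calc (n : ℝ) ^ (1 - c) * (Real.Gamma n * (n : ℝ) ^ c)
        = ((n : ℝ) ^ (1 - c) * (n : ℝ) ^ c) * Real.Gamma n := by ring
      _ = n * Real.Gamma n := by rw [e2]
      _ ≤ _ := by linarith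
  · filter_upwards [eventually_gt_atTop 0] with n hn
    have hn' : (0 : ℝ) < n := by exact_mod_cast hn
    have hG := Real.Gamma_pos_of_pos hn'
    have h := Real.Gamma_mul_add_mul_le_rpow_Gamma_mul_rpow_Gamma hn'
      (by positivity : (0 : ℝ) < n + 1) (sub_pos.2 h1) h0 (by ring)
    have e : (1 - c) * (n : ℝ) + c * (n + 1) = n + c := by ring
    rw [e, Real.Gamma_add_one hn'.ne', Real.mul_rpow hn'.le hG.le, mul_left_comm,
      ← Real.rpow_add hG, sub_add_cancel, Real.rpow_one] at h
    rw [div_le_one (by positivity)]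
    linarith

lemma gamma_ratio_limit (a b γ : ℝ) (ha0 : 0 < a) (ha1 : a < 1) (hb0 : 0 < b) (hb1 : b < 1)
    (hγ0 : 0 < γ) (τ : ℕ → ℕ) (hτ : ∀ t : ℕ, τ t = ⌈(t : ℝ) ^ γ⌉₊) :
    Tendsto (fun t : ℕ =>
      (Real.Gamma ((τ t : ℝ) + b) * Real.Gamma ((t : ℝ) + a) /
        (Real.Gamma ((τ t : ℝ) + a) * Real.Gamma t)) / (t : ℝ) ^ (γ * b + (1 - γ) * a))
      atTop (nhds 1) := by
  have hpow : Tendsto (fun t : ℕ => (t : ℝ) ^ γ) atTop atTop :=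
    (tendsto_rpow_atTop hγ0).comp tendsto_natCast_atTop_atTop
  have hτt : Tendsto τ atTop atTop := by
    have h := tendsto_nat_ceil_atTop.comp hpow
    exact h.congr (fun t => (hτ t).symm)
  have hr : Tendsto (fun t : ℕ => (τ t : ℝ) / (t : ℝ) ^ γ) atTop (nhds 1) := by
    have h := (tendsto_nat_ceil_div_atTop (R := ℝ)).comp hpow
    exact h.congr (fun t => by simp [hτ t])
  have hr2 := hr.rpow_const (p := b - a) (Or.inl one_ne_zero)
  have H := ((((wendel_limit b hb0 hb1).comp hτt).div ((wendel_limit a ha0 ha1).comp hτt)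
    one_ne_zero).mul (wendel_limit a ha0 ha1)).mul hr2
  simp only [Real.one_rpow, div_one, mul_one] at H
  refine H.congr' ?_
  filter_upwards [eventually_gt_atTop 0, hτt.eventually_gt_atTop 0] with t ht hs
  have ht' : (0 : ℝ) < t := by exact_mod_cast ht
  have hs' : (0 : ℝ) < τ t := by exact_mod_cast hs
  have g1 := Real.Gamma_pos_of_pos ht'
  have g2 := Real.Gamma_pos_of_pos hs'
  have g3 := Real.Gamma_pos_of_pos (add_pos hs' ha0)
  have e1 : (t : ℝ) ^ (γ * b + (1 - γ) * a) = ((t : ℝ) ^ γ) ^ (b - a) * (t : ℝ) ^ a := by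
    rw [← Real.rpow_mul ht'.le, ← Real.rpow_add ht']
    congr 1; ring
  have p1 : 0 < ((t : ℝ) ^ γ) ^ (b - a) := by positivity
  simp only [Function.comp, Pi.div_apply]
  rw [e1, Real.div_rpow hs'.le (by positivity), Real.rpow_sub hs']
  have p2 : 0 < (τ t : ℝ) ^ a := by positivity
  have p3 : 0 < (τ t : ℝ) ^ b := by positivity
  have p4 : 0 < (t : ℝ) ^ a := by positivity
  field_simp

/-- Early anomaly (`τ_t = ⌈t^γ⌉`): the Gamma-ratio in the expected degree of the oldest
vertex is asymptotic to `t^{γb + (1-γ)a}`, so an early anomaly changes the polynomial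
exponent of the oldest vertex's degree growth. -/
theorem oldest_vertex_degree_early_anomaly
    (m : ℕ) (hm : 1 ≤ m) (δ β γ : ℝ) (hδ : -(m : ℝ) < δ) (hβ : 0 < β)
    (hγ0 : 0 < γ) (hγ1 : γ < 1)
    (τ : ℕ → ℕ) (hτ : ∀ t : ℕ, τ t = ⌈(t : ℝ) ^ γ⌉₊) :
    Filter.Tendsto (fun t : ℕ =>
      (Real.Gamma ((τ t : ℝ) + m / (2 * m + δ)) *
          Real.Gamma ((t : ℝ) + m / (2 * m + β + δ)) /
        (Real.Gamma ((τ t : ℝ) + m / (2 * m + β + δ)) * Real.Gamma t)) /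
        (t : ℝ) ^ (γ * ((m : ℝ) / (2 * m + δ)) + (1 - γ) * ((m : ℝ) / (2 * m + β + δ))))
      Filter.atTop (nhds 1) ∧
    Filter.Tendsto (fun t : ℕ =>
      ((2 * m + δ) * Real.Gamma ((τ t : ℝ) + m / (2 * m + δ)) *
          Real.Gamma ((t : ℝ) + m / (2 * m + β + δ)) * Real.Gamma 1 /
        (Real.Gamma (1 + m / (2 * m + δ)) *
          Real.Gamma ((τ t : ℝ) + m / (2 * m + β + δ)) * Real.Gamma t)) /
        (((2 * m + δ) / Real.Gamma (1 + m / (2 * m + δ))) *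
          (t : ℝ) ^ (γ / (2 + δ / m) + (1 - γ) / (2 + β / m + δ / m))))
      Filter.atTop (nhds 1) := by
  have hm' : (1 : ℝ) ≤ m := by exact_mod_cast hm
  have hm0 : (0 : ℝ) < m := by linarith
  have d1 : (0 : ℝ) < 2 * m + δ := by linarith
  have d2 : (0 : ℝ) < 2 * m + β + δ := by linarith
  have hb0 : (0 : ℝ) < m / (2 * m + δ) := by positivity
  have hb1 : (m : ℝ) / (2 * m + δ) < 1 := by rw [div_lt_one d1]; linarith
  have ha0 : (0 : ℝ) < m / (2 * m + β + δ) := by positivity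
  have ha1 : (m : ℝ) / (2 * m + β + δ) < 1 := by rw [div_lt_one d2]; linarith
  have H := gamma_ratio_limit _ _ γ ha0 ha1 hb0 hb1 hγ0 τ hτ
  refine ⟨H, H.congr fun t => ?_⟩
  have e1 : γ / (2 + δ / m) = γ * ((m : ℝ) / (2 * m + δ)) := by
    have : 2 + δ / m = (2 * m + δ) / m := by field_simp
    rw [this, div_div_eq_mul_div, mul_div_assoc]
  have e2 : (1 - γ) / (2 + β / m + δ / m) = (1 - γ) * ((m : ℝ) / (2 * m + β + δ)) := by
    have : 2 + β / m + δ / m = (2 * m + β + δ) / m := by field_simp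
    rw [this, div_div_eq_mul_div, mul_div_assoc]
  rw [e1, e2, Real.Gamma_one]
  have g := Real.Gamma_pos_of_pos (add_pos one_pos hb0)
  generalize Real.Gamma (1 + (m : ℝ) / (2 * m + δ)) = G at *
  generalize Real.Gamma ((τ t : ℝ) + m / (2 * m + δ)) = A
  generalize Real.Gamma ((τ t : ℝ) + m / (2 * m + β + δ)) = B
  generalize Real.Gamma ((t : ℝ) + m / (2 * m + β + δ)) = C
  generalize Real.Gamma (t : ℝ) = D
  generalize (t : ℝ) ^ (γ * ((m : ℝ) / (2 * m + δ)) + (1 - γ) * ((m : ℝ) / (2 * m + β + δ))) = E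
  have : (2 * m + δ) * A * C * 1 / (G * B * D) = ((2 * m + δ) / G) * (A * C / (B * D)) := by
    rw [div_mul_div_comm]; ring
  rw [this, mul_div_mul_left _ _ (by positivity)]
end
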